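/- There exist a constant C < ∞ and h₀ > 0 such that for all 0 < δ < 1 and all 0 < h ≤ h₀: ∫_ℝ ū_δ(x) dx ≤ C·ψ⁻¹(1/δ), ∫_ℝ ū_δ(x)² dx ≤ C·(ψ⁻¹(1/δ))², ∫_ℝ v̄_δ(x) dx ≤ C·h/δ³, ∫_ℝ v̄_δ(x)² dx ≤ C·h²/δ⁶, ∫_ℝ w̄_δ(x) dx ≤ C·h²/δ³, and ∫_ℝ w̄_δ(x)² dx ≤ C·h⁴/δ⁶. -/

import Mathlib

noncomputable def pdens (ψ : ℝ → ℝ) (s x : ℝ) : ℝ :=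
  (1 / Real.pi) * ∫ p in Set.Ioi (0:ℝ), Real.cos (p * x) * Real.exp (-s * ψ p)

noncomputable def psiInv (ψ : ℝ → ℝ) (u : ℝ) : ℝ :=
  sInf {l : ℝ | 0 < l ∧ u ≤ ψ l}

noncomputable def ubar (ψ : ℝ → ℝ) (δ x : ℝ) : ℝ :=
  sSup ((fun r => pdens ψ r x) '' Set.Icc δ 1)

noncomputable def vbar (ψ : ℝ → ℝ) (δ h x : ℝ) : ℝ :=
  sSup ((fun r => |pdens ψ r (x + h) - pdens ψ r x|) '' Set.Icc δ 1)

noncomputable def wbar (ψ : ℝ → ℝ) (δ h x : ℝ) : ℝ :=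
  sSup ((fun r => |2 * pdens ψ r x - pdens ψ r (x + h) - pdens ψ r (x - h)|) '' Set.Icc δ 1)

open MeasureTheory Filter Topology Set in
/-- Integrating by parts twice on the half-line against a phase-shifted cosine. -/
lemma aux_ibp (g g1 g2 : ℝ → ℝ) (l0 l1 x θ : ℝ)
    (hg : ∀ p ∈ Ioi (0:ℝ), HasDerivAt g (g1 p) p)
    (hg1 : ∀ p ∈ Ioi (0:ℝ), HasDerivAt g1 (g2 p) p)
    (ig : IntegrableOn g (Ioi 0)) (ig2 : IntegrableOn g2 (Ioi 0))
    (z0 : Tendsto g (𝓝[>] 0) (𝓝 l0)) (z1 : Tendsto g1 (𝓝[>] 0) (𝓝 l1))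
    (t0 : Tendsto g atTop (𝓝 0)) (t1 : Tendsto g1 atTop (𝓝 0))
    (hθ : l0 * Real.sin θ = 0) :
    x ^ 2 * |∫ p in Ioi (0:ℝ), Real.cos (p * x + θ) * g p| ≤ |l1| + ∫ p in Ioi (0:ℝ), |g2 p| := by
  have cint : ∀ f : ℝ → ℝ, IntegrableOn f (Ioi 0) →
      IntegrableOn (fun p => Real.cos (p * x + θ) * f p) (Ioi 0) := by
    intro f hf
    refine Integrable.mono' hf.norm ?_ ?_
    · exact (Continuous.aestronglyMeasurable (by fun_prop)).mul hf.aestronglyMeasurable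
    · refine Eventually.of_forall fun p => ?_
      rw [norm_mul]
      exact mul_le_of_le_one_left (norm_nonneg _) (Real.abs_cos_le_one _)
  have i1 := cint g ig
  have i2 := cint g2 ig2
  have hlin : ∀ p : ℝ, HasDerivAt (fun p : ℝ => p * x + θ) x p := by
    intro p
    simpa using ((hasDerivAt_id p).mul_const x).add_const θ
  have key := integral_Ioi_deriv_mul_eq_sub (a := (0:ℝ))
    (u := fun p => x * Real.sin (p * x + θ) * g p + Real.cos (p * x + θ) * g1 p)
    (v := fun _ => (1:ℝ)) (v' := fun _ => (0:ℝ))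
    (u' := fun p => x ^ 2 * (Real.cos (p * x + θ) * g p) + Real.cos (p * x + θ) * g2 p)
    (a' := Real.cos θ * l1) (b' := 0) ?_ ?_ ?_ ?_ ?_
  · simp only [mul_one, mul_zero, add_zero] at key
    rw [integral_add (i1.const_mul _) i2, integral_const_mul] at key
    have e : x ^ 2 * |∫ p in Ioi (0:ℝ), Real.cos (p * x + θ) * g p|
        = |x ^ 2 * ∫ p in Ioi (0:ℝ), Real.cos (p * x + θ) * g p| := by
      rw [abs_mul, abs_of_nonneg (sq_nonneg x)]
    rw [e]
    have e2 : x ^ 2 * ∫ p in Ioi (0:ℝ), Real.cos (p * x + θ) * g p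
        = -(Real.cos θ * l1) - ∫ p in Ioi (0:ℝ), Real.cos (p * x + θ) * g2 p := by linarith
    rw [e2]
    refine (abs_sub _ _).trans (add_le_add ?_ ?_)
    · rw [abs_neg, abs_mul]
      exact mul_le_of_le_one_left (abs_nonneg _) (Real.abs_cos_le_one _)
    · refine (abs_integral_le_integral_abs).trans ?_
      refine integral_mono i2.abs ig2.abs fun p => ?_
      simp only [abs_mul]
      exact mul_le_of_le_one_left (abs_nonneg _) (Real.abs_cos_le_one _)
  · intro p hp
    have h1 := (((hlin p).sin.const_mul x).mul (hg p hp)).add ((hlin p).cos.mul (hg1 p hp))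
    refine h1.congr_deriv ?_
    ring
  · intro p _
    exact hasDerivAt_const _ _
  · have := (i1.const_mul (x^2)).add i2
    refine this.congr (Eventually.of_forall fun p => ?_)
    simp
  · have hs : Tendsto (fun p : ℝ => Real.sin (p * x + θ)) (𝓝[>] 0) (𝓝 (Real.sin θ)) := by
      have : Continuous (fun p : ℝ => Real.sin (p * x + θ)) := by fun_prop
      have := (this.tendsto 0).mono_left (nhdsWithin_le_nhds (s := Ioi 0))
      simpa using this
    have hc : Tendsto (fun p : ℝ => Real.cos (p * x + θ)) (𝓝[>] 0) (𝓝 (Real.cos θ)) := by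
      have : Continuous (fun p : ℝ => Real.cos (p * x + θ)) := by fun_prop
      have := (this.tendsto 0).mono_left (nhdsWithin_le_nhds (s := Ioi 0))
      simpa using this
    have := ((hs.const_mul x).mul z0).add (hc.mul z1)
    have e : x * Real.sin θ * l0 + Real.cos θ * l1 = Real.cos θ * l1 := by
      linear_combination x * hθ
    rw [e] at this
    refine this.congr fun p => ?_
    simp
  · have a0 : Tendsto (fun p => x * Real.sin (p * x + θ) * g p) atTop (𝓝 0) := by
      have hb : Tendsto (fun p => |x| * |g p|) atTop (𝓝 0) := by
        simpa using (t0.abs.const_mul |x|)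
      refine squeeze_zero_norm (fun p => ?_) hb
      rw [Real.norm_eq_abs, abs_mul, abs_mul]
      gcongr
      exact mul_le_of_le_one_right (abs_nonneg _) (Real.abs_sin_le_one _)
    have a1 : Tendsto (fun p => Real.cos (p * x + θ) * g1 p) atTop (𝓝 0) := by
      have hb : Tendsto (fun p => |g1 p|) atTop (𝓝 0) := by
        simpa using t1.abs
      refine squeeze_zero_norm (fun p => ?_) hb
      rw [Real.norm_eq_abs, abs_mul]
      exact mul_le_of_le_one_left (abs_nonneg _) (Real.abs_cos_le_one _)
    have := a0.add a1
    rw [add_zero] at this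
    refine this.congr fun p => ?_
    simp

open MeasureTheory Filter Topology Set in
/-- A pointwise bound by a translated Cauchy kernel bounds the integral and the
integral of the square; no measurability is needed. -/
lemma aux_final (F : ℝ → ℝ) (M τ : ℝ) (hM : 0 ≤ M)
    (hF : ∀ x, |F x| ≤ M * (1 + (x + τ) ^ 2)⁻¹) :
    (∫ x, F x) ≤ M * Real.pi ∧ (∫ x, F x ^ 2) ≤ M ^ 2 * Real.pi := by
  have ik : Integrable (fun x : ℝ => (1 + (x + τ) ^ 2)⁻¹) :=
    integrable_inv_one_add_sq.comp_add_right τ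
  have ek : ∫ x : ℝ, (1 + (x + τ) ^ 2)⁻¹ = Real.pi := by
    rw [integral_add_right_eq_self (fun x : ℝ => (1 + x ^ 2)⁻¹) τ, integral_univ_inv_one_add_sq]
  constructor
  · by_cases hi : Integrable F
    · calc ∫ x, F x ≤ ∫ x, M * (1 + (x + τ) ^ 2)⁻¹ :=
            integral_mono hi (ik.const_mul M) fun x => (le_abs_self _).trans (hF x)
        _ = _ := by rw [integral_const_mul, ek]
    · rw [integral_undef hi]
      positivity
  · calc ∫ x, F x ^ 2 ≤ ∫ x, M ^ 2 * (1 + (x + τ) ^ 2)⁻¹ := by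
          refine integral_mono_of_nonneg (Eventually.of_forall fun x => sq_nonneg _)
            (ik.const_mul _) (Eventually.of_forall fun x => ?_)
          have h1 : F x ^ 2 ≤ (M * (1 + (x + τ) ^ 2)⁻¹) ^ 2 := by
            rw [← sq_abs (F x)]
            exact pow_le_pow_left₀ (abs_nonneg _) (hF x) 2
          refine h1.trans ?_
          rw [mul_pow]
          refine mul_le_mul_of_nonneg_left ?_ (sq_nonneg M)
          have h0 : 0 ≤ (1 + (x + τ) ^ 2)⁻¹ := by positivity
          have h2 : (1 + (x + τ) ^ 2)⁻¹ ≤ 1 := inv_le_one_of_one_le₀ (by nlinarith [sq_nonneg (x+τ)])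
          nlinarith
      _ = _ := by rw [integral_const_mul, ek]

/-- Combining a uniform bound and an inverse square bound. -/
lemma aux_comb (a M y : ℝ) (h1 : |a| ≤ M) (h2 : y ^ 2 * |a| ≤ M) :
    |a| ≤ 2 * M * (1 + y ^ 2)⁻¹ := by
  rw [← div_eq_mul_inv, le_div_iff₀ (by positivity)]
  linarith

/-- The supremum over a nonempty family inherits a bound in absolute value. -/
lemma aux_sup (F : ℝ → ℝ) (δ B : ℝ) (hδ : δ < 1) (h : ∀ r ∈ Set.Icc δ 1, |F r| ≤ B) :
    |sSup (F '' Set.Icc δ 1)| ≤ B := by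
  have hne : (F '' Set.Icc δ 1).Nonempty := ⟨F 1, 1, ⟨hδ.le, le_rfl⟩, rfl⟩
  rw [abs_le]
  constructor
  · have : F 1 ≤ sSup (F '' Set.Icc δ 1) := by
      refine le_csSup ⟨B, ?_⟩ ⟨1, ⟨hδ.le, le_rfl⟩, rfl⟩
      rintro _ ⟨r, hr, rfl⟩
      exact (abs_le.1 (h r hr)).2
    linarith [(abs_le.1 (h 1 ⟨hδ.le, le_rfl⟩)).1]
  · refine csSup_le hne ?_
    rintro _ ⟨r, hr, rfl⟩
    exact (abs_le.1 (h r hr)).2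

open MeasureTheory Filter Topology Set in
/-- Linear growth between comparable large arguments. -/
lemma aux_growth (β : ℝ) (hβ1 : 1 < β) (ψ : ℝ → ℝ)
    (hpos : ∀ p : ℝ, p ≠ 0 → 0 < ψ p)
    (hRV : ∀ l : ℝ, 0 < l → Tendsto (fun x => ψ (l * x) / ψ x) atTop (𝓝 (l ^ β)))
    (hdiff1 : ∀ p : ℝ, 0 < p → DifferentiableAt ℝ ψ p)
    (D₁ : ℝ) (hD1 : ∀ l : ℝ, 1 ≤ l → l * |deriv ψ l| ≤ D₁ * ψ l) :
    ∃ X c : ℝ, 1 ≤ X ∧ 0 < c ∧ ∀ q p, X ≤ q → q ≤ p → c * (p / q) * ψ q ≤ ψ p := by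
  obtain ⟨N, hN⟩ := exists_nat_ge D₁
  have hmono : MonotoneOn (fun l => l ^ N * ψ l) (Ici 1) := by
    have hd : ∀ l : ℝ, 0 < l →
        HasDerivAt (fun l => l ^ N * ψ l) (N * l ^ (N - 1) * ψ l + l ^ N * deriv ψ l) l := by
      intro l hl
      exact (hasDerivAt_pow N l).mul (hdiff1 l hl).hasDerivAt
    refine monotoneOn_of_deriv_nonneg (convex_Ici 1) ?_ ?_ ?_
    · intro l hl
      exact (hd l (lt_of_lt_of_le one_pos hl)).continuousAt.continuousWithinAt
    · intro l hl
      rw [interior_Ici] at hl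
      exact (hd l (one_pos.trans hl)).differentiableAt.differentiableWithinAt
    · intro l hl
      rw [interior_Ici] at hl
      have hl0 : 0 < l := one_pos.trans hl
      rw [(hd l hl0).deriv]
      have hp := hpos l hl0.ne'
      have h1 := hD1 l (le_of_lt hl)
      have h2 : -(l * |deriv ψ l|) ≤ l * deriv ψ l := by
        have := neg_abs_le (deriv ψ l)
        nlinarith
      have h3 : D₁ * ψ l ≤ N * ψ l := mul_le_mul_of_nonneg_right hN hp.le
      have h4 : 0 ≤ N * ψ l + l * deriv ψ l := by linarith
      have h5 : l * (N * l ^ (N - 1) * ψ l + l ^ N * deriv ψ l)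
          = l ^ N * (N * ψ l + l * deriv ψ l) := by
        rcases Nat.eq_zero_or_pos N with h | h
        · subst h; simp
        · obtain ⟨k, rfl⟩ : ∃ k, N = k + 1 := ⟨N - 1, by omega⟩
          simp only [Nat.add_sub_cancel]
          ring
      have h6 : 0 ≤ l * (N * l ^ (N - 1) * ψ l + l ^ N * deriv ψ l) := by
        rw [h5]; positivity
      exact nonneg_of_mul_nonneg_right h6 hl0
  have h2 : (2:ℝ) < 2 ^ β := by
    have := Real.rpow_lt_rpow_of_exponent_lt (x := 2) (by norm_num) hβ1
    simpa using this
  obtain ⟨X0, hX0⟩ := eventually_atTop.1 ((hRV 2 two_pos).eventually (lt_mem_nhds h2))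
  refine ⟨max X0 1, (2 ^ N)⁻¹ / 2, le_max_right _ _, by positivity, ?_⟩
  have hstep : ∀ x, max X0 1 ≤ x → 2 * ψ x ≤ ψ (2 * x) := by
    intro x hx
    have h := hX0 x ((le_max_left _ _).trans hx)
    have hx1 : 1 ≤ x := (le_max_right _ _).trans hx
    rw [lt_div_iff₀ (hpos x (by linarith))] at h
    exact h.le
  have hbase : ∀ q p, max X0 1 ≤ q → q ≤ p → p ≤ 2 * q → (2 ^ N)⁻¹ / 2 * (p / q) * ψ q ≤ ψ p := by
    intro q p hq hqp hp2
    have hq1 : 1 ≤ q := (le_max_right _ _).trans hq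
    have hq0 : 0 < q := by linarith
    have hp1 : 1 ≤ p := hq1.trans hqp
    have hm := hmono (mem_Ici.2 hq1) (mem_Ici.2 hp1) hqp
    simp only at hm
    have hψp := hpos p (by linarith)
    have hψq := hpos q (by linarith)
    have h7 : p ^ N ≤ 2 ^ N * q ^ N := by
      rw [← mul_pow]
      exact pow_le_pow_left₀ (by linarith) hp2 N
    have h8 : q ^ N * ψ q ≤ q ^ N * (2 ^ N * ψ p) := by nlinarith
    have h9 : ψ q ≤ 2 ^ N * ψ p := le_of_mul_le_mul_left h8 (by positivity)
    have h10 : p / q ≤ 2 := by rw [div_le_iff₀ hq0]; exact hp2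
    calc (2 ^ N)⁻¹ / 2 * (p / q) * ψ q ≤ (2 ^ N)⁻¹ / 2 * 2 * (2 ^ N * ψ p) := by gcongr
      _ = ψ p := by field_simp
  have hind : ∀ n : ℕ, ∀ q p, max X0 1 ≤ q → q ≤ p → p ≤ 2 ^ n * q →
      (2 ^ N)⁻¹ / 2 * (p / q) * ψ q ≤ ψ p := by
    intro n
    induction n with
    | zero =>
      intro q p hq hqp hp
      have hq1 : 1 ≤ q := (le_max_right _ _).trans hq
      exact hbase q p hq hqp (by simp at hp; linarith)
    | succ n ih =>
      intro q p hq hqp hp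
      rcases le_total p (2 * q) with h | h
      · exact hbase q p hq hqp h
      · have h1 := ih q (p / 2) hq (by linarith) (by rw [pow_succ] at hp; linarith)
        have h2 := hstep (p / 2) (by linarith)
        rw [show 2 * (p / 2) = p by ring] at h2
        calc (2 ^ N)⁻¹ / 2 * (p / q) * ψ q = 2 * ((2 ^ N)⁻¹ / 2 * (p / 2 / q) * ψ q) := by ring
          _ ≤ 2 * ψ (p / 2) := by linarith
          _ ≤ ψ p := h2
  intro q p hq hqp
  have hq1 : 1 ≤ q := (le_max_right _ _).trans hq
  obtain ⟨n, hn⟩ := pow_unbounded_of_one_lt (p / q) (one_lt_two)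
  refine hind n q p hq hqp ?_
  rw [div_lt_iff₀ (by linarith)] at hn
  exact hn.le

open MeasureTheory Filter Topology Set in
/-- The lower bound on the generalized inverse and the bound of `∫ exp (-δ ψ)`. -/
lemma aux_inv (ψ : ℝ → ℝ) (hmeas : Measurable ψ)
    (hnonneg : ∀ p : ℝ, 0 ≤ ψ p) (hpos : ∀ p : ℝ, p ≠ 0 → 0 < ψ p)
    (C₀ : ℝ) (hC0 : ∀ p : ℝ, ψ p ≤ C₀ * p ^ 2)
    (X c : ℝ) (hX : 1 ≤ X) (hc : 0 < c)
    (hg : ∀ q p, X ≤ q → q ≤ p → c * (p / q) * ψ q ≤ ψ p) :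
    ∃ r₀ C : ℝ, 0 < r₀ ∧ 0 ≤ C ∧ ∀ δ : ℝ, 0 < δ → δ < 1 → r₀ ≤ psiInv ψ (1 / δ) ∧
      ∫ p in Ioi (0:ℝ), Real.exp (-δ * ψ p) ≤ C * psiInv ψ (1 / δ) := by
  have hC0pos : 0 < C₀ := by
    have h1 := hC0 1
    have h2 := hpos 1 one_ne_zero
    linarith
  have hψX : 0 < ψ X := hpos X (by linarith)
  have hX0 : 0 < X := by linarith
  set r₀ : ℝ := 1 / (1 + C₀) with hr0
  have hr0pos : 0 < r₀ := by positivity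
  set c' : ℝ := min 1 (ψ X / (C₀ * X ^ 2)) with hc'
  have hc'pos : 0 < c' := lt_min one_pos (by positivity)
  set T : ℝ := 2 + X / r₀ with hT
  have hTpos : 0 < T := by positivity
  refine ⟨r₀, (1 + 1 / (c * c')) * T, hr0pos, by positivity, ?_⟩
  intro δ hδ hδ1
  have h1δ : 1 ≤ 1 / δ := by rw [le_div_iff₀ hδ]; linarith
  have hlow : ∀ l ∈ {l : ℝ | 0 < l ∧ 1 / δ ≤ ψ l}, r₀ ≤ l := by
    rintro l ⟨hl0, hl⟩
    by_contra hlt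
    push Not at hlt
    have h3 := hC0 l
    have h4 : l * (1 + C₀) < 1 := by rwa [hr0, lt_div_iff₀ (by positivity)] at hlt
    have h5 : l < 1 := by nlinarith
    nlinarith [mul_pos hC0pos hl0]
  have hne : {l : ℝ | 0 < l ∧ 1 / δ ≤ ψ l}.Nonempty := by
    have hk : 0 < c * ψ X / X := by positivity
    refine ⟨max X ((1 / δ) / (c * ψ X / X)), lt_of_lt_of_le hX0 (le_max_left _ _), ?_⟩
    have h := hg X _ le_rfl (le_max_left X ((1 / δ) / (c * ψ X / X)))
    refine le_trans ?_ h
    have h2 : (1 / δ) / (c * ψ X / X) ≤ max X ((1 / δ) / (c * ψ X / X)) := le_max_right _ _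
    rw [div_le_iff₀ hk] at h2
    refine h2.trans (le_of_eq ?_)
    ring
  have hR : r₀ ≤ psiInv ψ (1 / δ) := le_csInf hne hlow
  refine ⟨hR, ?_⟩
  set R := psiInv ψ (1 / δ) with hRdef
  have hR0 : 0 < R := hr0pos.trans_le hR
  obtain ⟨l, ⟨hl0, hl⟩, hl2⟩ : ∃ l ∈ {l : ℝ | 0 < l ∧ 1 / δ ≤ ψ l}, l < 2 * R :=
    exists_lt_of_csInf_lt hne (by change R < 2 * R; linarith)
  set M := max l X with hMdef
  have hM0 : 0 < M := lt_of_lt_of_le hl0 (le_max_left _ _)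
  have hMT : M ≤ T * R := by
    have h1 : X ≤ X / r₀ * R := by
      rw [div_mul_eq_mul_div, le_div_iff₀ hr0pos]
      exact mul_le_mul_of_nonneg_left hR hX0.le
    have h2 : 0 ≤ X / r₀ * R := by positivity
    rw [hT, add_mul]
    exact max_le (by linarith) (by linarith)
  have hψM : c' ≤ δ * ψ M := by
    have hl' : 1 ≤ δ * ψ l := by rw [div_le_iff₀ hδ] at hl; linarith
    rcases le_total X l with h | h
    · rw [hMdef, max_eq_left h]
      exact (min_le_left _ _).trans hl'
    · rw [hMdef, max_eq_right h]
      have h1 : ψ l ≤ C₀ * X ^ 2 := (hC0 l).trans (by gcongr)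
      have h2 : c' * (C₀ * X ^ 2) ≤ ψ X := by
        rw [← le_div_iff₀ (by positivity)]
        exact min_le_right _ _
      have h3 : 1 ≤ δ * (C₀ * X ^ 2) := hl'.trans (by gcongr)
      calc c' ≤ c' * (δ * (C₀ * X ^ 2)) := le_mul_of_one_le_right hc'pos.le h3
        _ = δ * (c' * (C₀ * X ^ 2)) := by ring
        _ ≤ δ * ψ X := by gcongr
  have hk : -(c * c' / M) < 0 := by
    have : 0 < c * c' / M := by positivity
    linarith
  have hdec : ∀ p ∈ Ioi M, Real.exp (-δ * ψ p) ≤ Real.exp (-(c * c' / M) * p) := by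
    intro p hp
    apply Real.exp_le_exp.2
    have h1 := hg M p (le_max_right _ _) (le_of_lt hp)
    have hp0 : 0 < p := hM0.trans hp
    have h2 : c * (p / M) * c' ≤ δ * ψ p := by
      calc c * (p / M) * c' ≤ c * (p / M) * (δ * ψ M) := by gcongr
        _ = δ * (c * (p / M) * ψ M) := by ring
        _ ≤ δ * ψ p := by gcongr
    have h3 : c * (p / M) * c' = (c * c' / M) * p := by ring
    linarith
  have hme : Measurable fun p => Real.exp (-δ * ψ p) := by fun_prop
  have iI : IntegrableOn (fun p => Real.exp (-δ * ψ p)) (Ioi M) := by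
    refine Integrable.mono' (integrableOn_exp_mul_Ioi hk M) hme.aestronglyMeasurable ?_
    refine (ae_restrict_iff' measurableSet_Ioi).2 (Eventually.of_forall fun p hp => ?_)
    rw [Real.norm_eq_abs, abs_of_pos (Real.exp_pos _)]
    exact hdec p hp
  have hle1 : ∀ p, Real.exp (-δ * ψ p) ≤ 1 := by
    intro p
    apply Real.exp_le_one_iff.2
    nlinarith [hnonneg p]
  have iM : IntegrableOn (fun p => Real.exp (-δ * ψ p)) (Ioc 0 M) := by
    refine Integrable.mono' (g := fun _ => (1:ℝ)) (by simp) hme.aestronglyMeasurable ?_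
    refine Eventually.of_forall fun p => ?_
    rw [Real.norm_eq_abs, abs_of_pos (Real.exp_pos _)]
    exact hle1 p
  rw [← Ioc_union_Ioi_eq_Ioi hM0.le, setIntegral_union (Ioc_disjoint_Ioi le_rfl) measurableSet_Ioi iM iI]
  have b1 : ∫ p in Ioc 0 M, Real.exp (-δ * ψ p) ≤ M := by
    calc ∫ p in Ioc 0 M, Real.exp (-δ * ψ p) ≤ ∫ p in Ioc 0 M, (1:ℝ) :=
          integral_mono iM (by simp) hle1
      _ = M := by simp [hM0.le]
  have b2 : ∫ p in Ioi M, Real.exp (-δ * ψ p) ≤ M / (c * c') := by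
    calc ∫ p in Ioi M, Real.exp (-δ * ψ p) ≤ ∫ p in Ioi M, Real.exp (-(c * c' / M) * p) :=
          setIntegral_mono_on iI (integrableOn_exp_mul_Ioi hk M) measurableSet_Ioi hdec
      _ = Real.exp (-(c * c' / M) * M) * (M / (c * c')) := by
          rw [integral_exp_mul_Ioi hk]
          field_simp
      _ ≤ 1 * (M / (c * c')) := by
          gcongr
          apply Real.exp_le_one_iff.2
          nlinarith
      _ = _ := one_mul _
  calc _ ≤ M + M / (c * c') := add_le_add b1 b2
    _ = (1 + 1 / (c * c')) * M := by ring
    _ ≤ (1 + 1 / (c * c')) * (T * R) := by gcongr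
    _ = _ := by ring

/-- `t exp (-t) ≤ exp (-t/2)` and `t² exp (-t) ≤ 8 exp (-t/2)`. -/
lemma aux_exp (t : ℝ) (ht : 0 ≤ t) :
    t * Real.exp (-t) ≤ 2 * Real.exp (-(t / 2)) ∧ t ^ 2 * Real.exp (-t) ≤ 8 * Real.exp (-(t / 2)) := by
  have e : Real.exp (-t) = Real.exp (-(t/2)) * Real.exp (-(t/2)) := by
    rw [← Real.exp_add]; ring_nf
  have h1 : t / 2 ≤ Real.exp (t / 2) := by linarith [Real.add_one_le_exp (t/2)]
  have h2 : 1 + t / 2 + (t / 2) ^ 2 / 2 ≤ Real.exp (t / 2) :=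
    Real.quadratic_le_exp_of_nonneg (by linarith)
  have h3 : Real.exp (t / 2) * Real.exp (-(t/2)) = 1 := by
    rw [← Real.exp_add]; simp
  have hp := Real.exp_pos (-(t/2))
  constructor
  · have : t * Real.exp (-(t/2)) ≤ 2 := by nlinarith
    rw [e]; nlinarith
  · have : t ^ 2 * Real.exp (-(t/2)) ≤ 8 := by nlinarith
    rw [e]; nlinarith

open MeasureTheory Filter Topology Set in
/-- The derivative of ψ has a limit at `0+` and is bounded on `(0,1]`. -/
lemma aux_deriv (ψ : ℝ → ℝ)
    (hdiff2 : ∀ p : ℝ, 0 < p → DifferentiableAt ℝ (deriv ψ) p)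
    (hint2 : IntegrableOn (fun l : ℝ => |deriv (deriv ψ) l|) (Ioc (0:ℝ) 1)) :
    ∃ L B : ℝ, 0 ≤ B ∧ Tendsto (deriv ψ) (𝓝[>] 0) (𝓝 L) ∧ ∀ p, 0 < p → p ≤ 1 → |deriv ψ p| ≤ B := by
  have hm : Measurable (deriv (deriv ψ)) := measurable_deriv _
  have hi : IntegrableOn (deriv (deriv ψ)) (Ioc 0 1) :=
    (integrable_norm_iff hm.aestronglyMeasurable).1 hint2
  have hrep : ∀ p, 0 < p → p ≤ 1 → deriv ψ p = deriv ψ 1 - ∫ t in p..1, deriv (deriv ψ) t := by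
    intro p hp hp1
    rw [intervalIntegral.integral_eq_sub_of_hasDerivAt (f := deriv ψ)]
    · ring
    · intro x hx
      rw [uIcc_of_le hp1] at hx
      exact (hdiff2 x (hp.trans_le hx.1)).hasDerivAt
    · rw [intervalIntegrable_iff_integrableOn_Ioc_of_le hp1]
      exact hi.mono_set (Ioc_subset_Ioc_left hp.le)
  refine ⟨deriv ψ 1 - ∫ t in (0:ℝ)..1, deriv (deriv ψ) t,
    |deriv ψ 1| + ∫ t in Ioc (0:ℝ) 1, |deriv (deriv ψ) t|, ?_, ?_, ?_⟩
  · have : 0 ≤ ∫ t in Ioc (0:ℝ) 1, |deriv (deriv ψ) t| := integral_nonneg fun _ => abs_nonneg _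
    positivity
  · have hc := intervalIntegral.continuousOn_primitive_interval_left (a := (0:ℝ)) (b := 1) (μ := volume)
      (f := deriv (deriv ψ)) (by rw [uIcc_of_le zero_le_one, integrableOn_Icc_iff_integrableOn_Ioc]; exact hi)
    rw [uIcc_of_le zero_le_one] at hc
    have h0 := (hc 0 ⟨le_rfl, zero_le_one⟩).tendsto.mono_left
      (nhdsWithin_mono (0:ℝ) (Ioc_subset_Icc_self (a := (0:ℝ)) (b := 1)))
    rw [nhdsWithin_Ioc_eq_nhdsGT one_pos] at h0
    refine (h0.const_sub (deriv ψ 1)).congr' ?_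
    filter_upwards [Ioc_mem_nhdsGT (one_pos : (0:ℝ) < 1)] with p hp
    exact (hrep p hp.1 hp.2).symm
  · intro p hp hp1
    rw [hrep p hp hp1]
    refine (abs_sub _ _).trans (add_le_add le_rfl ?_)
    rw [intervalIntegral.integral_of_le hp1]
    refine abs_integral_le_integral_abs.trans ?_
    exact setIntegral_mono_set hint2 (Eventually.of_forall fun _ => abs_nonneg _)
      (Ioc_subset_Ioc_left hp.le).eventuallyLE

set_option maxHeartbeats 2000000 in
open MeasureTheory Filter Topology Set in
/-- Pointwise bounds on `exp (-s ψ)` and its first two derivatives. -/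
lemma aux_bounds (ψ : ℝ → ℝ) (hnonneg : ∀ p : ℝ, 0 ≤ ψ p) (hpos : ∀ p : ℝ, p ≠ 0 → 0 < ψ p)
    (D₁ D₂ : ℝ)
    (hD1 : ∀ l : ℝ, 1 ≤ l → l * |deriv ψ l| ≤ D₁ * ψ l)
    (hD2 : ∀ l : ℝ, 1 ≤ l → l ^ 2 * |deriv (deriv ψ) l| ≤ D₂ * ψ l)
    (hint2 : IntegrableOn (fun l : ℝ => |deriv (deriv ψ) l|) (Ioc (0:ℝ) 1))
    (X c : ℝ) (hX : 1 ≤ X) (hc : 0 < c)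
    (hg : ∀ q p, X ≤ q → q ≤ p → c * (p / q) * ψ q ≤ ψ p)
    (B : ℝ) (hB0 : 0 ≤ B) (hB : ∀ p, 0 < p → p ≤ 1 → |deriv ψ p| ≤ B) :
    ∃ (q A : ℝ) (m : ℝ → ℝ), 0 < q ∧ 0 ≤ A ∧ (∀ p, 0 ≤ m p) ∧ IntegrableOn m (Ioi 0) ∧
      ∀ s p : ℝ, 0 < s → s ≤ 1 → 0 < p →
        (1 + p ^ 2) * Real.exp (-s * ψ p) ≤ A * ((s ^ 2)⁻¹ * Real.exp (-(q * s) * p)) ∧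
        (1 + p ^ 2) * |-s * deriv ψ p * Real.exp (-s * ψ p)|
          ≤ A * ((s ^ 2)⁻¹ * Real.exp (-(q * s) * p)) ∧
        (1 + p ^ 2) * |((s * deriv ψ p) ^ 2 - s * deriv (deriv ψ) p) * Real.exp (-s * ψ p)|
          ≤ A * ((s ^ 2)⁻¹ * Real.exp (-(q * s) * p)) + 2 * m p ∧
        |((s * deriv ψ p) ^ 2 - s * deriv (deriv ψ) p) * Real.exp (-s * ψ p)|
          ≤ A * (1 + p ^ 2)⁻¹ + m p := by
  have hψ1 := hpos 1 one_ne_zero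
  have hX0 : 0 < X := by linarith
  have hψX : 0 < ψ X := hpos X hX0.ne'
  have hD1n : 0 ≤ D₁ := by
    have h := hD1 1 le_rfl
    have h' := abs_nonneg (deriv ψ 1)
    by_contra hh
    push Not at hh
    nlinarith
  have hD2n : 0 ≤ D₂ := by
    have h := hD2 1 le_rfl
    have h' := abs_nonneg (deriv (deriv ψ) 1)
    by_contra hh
    push Not at hh
    nlinarith
  set κ : ℝ := c * ψ X / X with hκ
  have hκ0 : 0 < κ := by positivity
  set K : ℝ := Real.exp (κ * X) with hK
  have hK1 : 1 ≤ K := Real.one_le_exp (by positivity)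
  -- basic exponential decay
  have hdec : ∀ t p : ℝ, 0 ≤ t → t ≤ 1 → 0 < p → Real.exp (-(t * ψ p)) ≤ K * Real.exp (-(t * κ * p)) := by
    intro t p ht ht1 hp
    rw [hK, ← Real.exp_add]
    apply Real.exp_le_exp.2
    rcases le_total X p with h | h
    · have h1 := hg X p le_rfl h
      have h2 : κ * p ≤ ψ p := by
        refine le_trans (le_of_eq ?_) h1
        rw [hκ]; ring
      have h3 : t * (κ * p) ≤ t * ψ p := by gcongr
      have h4 : 0 < κ * X := by positivity
      linarith
    · have h1 : t * κ * p ≤ 1 * κ * X := by gcongr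
      have h2 : 0 ≤ t * ψ p := mul_nonneg ht (hnonneg p)
      linarith
  set J : ℝ := 1 + 32 / κ ^ 2 with hJ
  have hJ1 : 1 ≤ J := by
    have : 0 < 32 / κ ^ 2 := by positivity
    linarith
  set q : ℝ := κ / 4 with hq
  have hq0 : 0 < q := by positivity
  -- absorbing a quadratic factor
  have hJb : ∀ s p : ℝ, 0 < s → s ≤ 1 → 0 < p →
      (1 + p ^ 2) * Real.exp (-(s / 2 * κ * p)) ≤ J * ((s ^ 2)⁻¹ * Real.exp (-(q * s) * p)) := by
    intro s p hs hs1 hp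
    have e : Real.exp (-(s / 2 * κ * p)) = Real.exp (-(q * s) * p) * Real.exp (-(q * s * p)) := by
      rw [← Real.exp_add, hq]; ring_nf
    have hz : 0 < q * s * p := by positivity
    have h2 : 1 + q * s * p + (q * s * p) ^ 2 / 2 ≤ Real.exp (q * s * p) :=
      Real.quadratic_le_exp_of_nonneg hz.le
    have h3 : Real.exp (q * s * p) * Real.exp (-(q * s * p)) = 1 := by
      rw [← Real.exp_add]; simp
    have hpz := Real.exp_pos (-(q * s * p))
    have h4 : (1 + p ^ 2) * s ^ 2 ≤ J * Real.exp (q * s * p) := by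
      have h5 : 32 / κ ^ 2 * ((q * s * p) ^ 2 / 2) = p ^ 2 * s ^ 2 := by
        rw [hq]; field_simp; norm_num
      have h6 : s ^ 2 ≤ 1 := by nlinarith
      have h7 : 32 / κ ^ 2 * ((q * s * p) ^ 2 / 2) ≤ 32 / κ ^ 2 * Real.exp (q * s * p) := by
        gcongr
        linarith [sq_nonneg (q * s * p)]
      have h8 : 1 ≤ Real.exp (q * s * p) := Real.one_le_exp hz.le
      rw [hJ]
      linarith
    have h9 : (1 + p ^ 2) * Real.exp (-(q * s * p)) ≤ J * (s ^ 2)⁻¹ := by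
      rw [← div_eq_mul_inv, le_div_iff₀ (by positivity)]
      calc (1 + p ^ 2) * Real.exp (-(q * s * p)) * s ^ 2
          = ((1 + p ^ 2) * s ^ 2) * Real.exp (-(q * s * p)) := by ring
        _ ≤ (J * Real.exp (q * s * p)) * Real.exp (-(q * s * p)) := by gcongr
        _ = J := by rw [mul_assoc, h3, mul_one]
    rw [e]
    calc (1 + p ^ 2) * (Real.exp (-(q * s) * p) * Real.exp (-(q * s * p)))
        = ((1 + p ^ 2) * Real.exp (-(q * s * p))) * Real.exp (-(q * s) * p) := by ring
      _ ≤ (J * (s ^ 2)⁻¹) * Real.exp (-(q * s) * p) := by gcongr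
      _ = _ := by ring
  set D : ℝ := 8 * D₁ ^ 2 + 2 * D₂ with hD
  have hDn : 0 ≤ D := by positivity
  set K' : ℝ := Real.exp (κ / 2) with hK'
  have hK'0 : 0 < K' := Real.exp_pos _
  -- a constant is absorbed on (0,1]
  have hone : ∀ s p : ℝ, 0 < s → s ≤ 1 → 0 < p → p ≤ 1 → 1 ≤ K' * Real.exp (-(s / 2 * κ * p)) := by
    intro s p hs hs1 hp hp1
    rw [hK', ← Real.exp_add]
    apply Real.one_le_exp
    have : s / 2 * κ * p ≤ 1 / 2 * κ * 1 := by gcongr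
    linarith
  set A : ℝ := K * J + 2 * D₁ * K * J + B * K' * J + 2 * D * K * J + 2 * B ^ 2 * K' * J
    + 2 * D + 2 * B ^ 2 with hA
  have hJ0 : 0 < J := by linarith
  have hK0 : 0 < K := by linarith
  have a1 : 0 ≤ K * J := by positivity
  have a2 : 0 ≤ 2 * D₁ * K * J := by positivity
  have a3 : 0 ≤ B * K' * J := by positivity
  have a4 : 0 ≤ 2 * D * K * J := by positivity
  have a5 : 0 ≤ 2 * B ^ 2 * K' * J := by positivity
  have a6 : 0 ≤ 2 * D := by positivity
  have a7 : 0 ≤ 2 * B ^ 2 := by positivity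
  refine ⟨q, A, (Ioc (0:ℝ) 1).indicator (fun l => |deriv (deriv ψ) l|), hq0, by positivity,
    fun p => indicator_nonneg (fun _ _ => abs_nonneg _) p, ?_, ?_⟩
  · exact ((integrable_indicator_iff measurableSet_Ioc).2 hint2).integrableOn
  intro s p hs hs1 hp
  set Q : ℝ := (s ^ 2)⁻¹ * Real.exp (-(q * s) * p) with hQ
  have hQ0 : 0 < Q := by positivity
  set E : ℝ := Real.exp (-(s / 2 * κ * p)) with hE
  have hE0 : 0 < E := Real.exp_pos _
  have hEQ : (1 + p ^ 2) * E ≤ J * Q := hJb s p hs hs1 hp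
  have hEQ' : E ≤ J * Q := by nlinarith [sq_nonneg p]
  set f : ℝ := Real.exp (-s * ψ p) with hf
  set F : ℝ := Real.exp (-(s * ψ p / 2)) with hF
  have hf0 : 0 < f := Real.exp_pos _
  have hF0 : 0 < F := Real.exp_pos _
  have hsψ : 0 ≤ s * ψ p := mul_nonneg hs.le (hnonneg p)
  have hFE : F ≤ K * E := by
    have := hdec (s / 2) p (by positivity) (by linarith) hp
    rwa [show s / 2 * ψ p = s * ψ p / 2 by ring] at this
  have hfF : f ≤ F := Real.exp_le_exp.2 (by linarith)
  have hF1 : F ≤ 1 := Real.exp_le_one_iff.2 (by linarith)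
  have hf1 : f ≤ 1 := hfF.trans hF1
  obtain ⟨x1, x2⟩ := aux_exp (s * ψ p) hsψ
  rw [show -(s * ψ p) = -s * ψ p by ring, ← hf, ← hF] at x1 x2
  have hp2 : 0 < 1 + p ^ 2 := by positivity
  clear_value A K K' J D q κ f F E Q
  have b1 : (1 + p ^ 2) * f ≤ A * Q := by
    calc (1 + p ^ 2) * f ≤ (1 + p ^ 2) * (K * E) := by gcongr; exact hfF.trans hFE
      _ = K * ((1 + p ^ 2) * E) := by ring
      _ ≤ K * (J * Q) := by gcongr
      _ = (K * J) * Q := by ring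
      _ ≤ A * Q := by gcongr; linarith
  refine ⟨b1, ?_⟩
  have habs1 : |-s * deriv ψ p * f| = s * |deriv ψ p| * f := by
    rw [abs_mul, abs_mul, abs_neg, abs_of_pos hs, abs_of_pos hf0]
  have habs2 : |((s * deriv ψ p) ^ 2 - s * deriv (deriv ψ) p) * f|
      ≤ ((s * |deriv ψ p|) ^ 2 + s * |deriv (deriv ψ) p|) * f := by
    rw [abs_mul, abs_of_pos hf0]
    gcongr
    refine (abs_sub _ _).trans (le_of_eq ?_)
    rw [abs_mul, abs_of_pos hs, abs_pow, abs_mul, abs_of_pos hs]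
  rw [habs1]
  set d1 := |deriv ψ p| with hd1
  set d2 := |deriv (deriv ψ) p| with hd2
  have hd1n : 0 ≤ d1 := abs_nonneg _
  have hd2n : 0 ≤ d2 := abs_nonneg _
  rcases le_or_gt p 1 with hp1 | hp1
  · have hm : (Ioc (0:ℝ) 1).indicator (fun l => |deriv (deriv ψ) l|) p = d2 :=
      indicator_of_mem (mem_Ioc.2 ⟨hp, hp1⟩) _
    rw [hm]
    have hb := hB p hp hp1
    have h1 := hone s p hs hs1 hp hp1
    rw [← hE] at h1
    have hp22 : 1 + p ^ 2 ≤ 2 := by nlinarith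
    have hsd : s * d1 ≤ B := by
      calc s * d1 ≤ 1 * B := by gcongr
        _ = B := one_mul _
    have hsd2 : s * d2 ≤ d2 := mul_le_of_le_one_left hd2n hs1
    have hsum : ((s * d1) ^ 2 + s * d2) * f ≤ B ^ 2 + d2 := by
      calc ((s * d1) ^ 2 + s * d2) * f ≤ (B ^ 2 + d2) * 1 := by gcongr
        _ = _ := mul_one _
    refine ⟨?_, ?_, ?_⟩
    · calc (1 + p ^ 2) * (s * d1 * f) ≤ (1 + p ^ 2) * (B * 1) := by gcongr
        _ = (1 + p ^ 2) * B * 1 := by ring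
        _ ≤ (1 + p ^ 2) * B * (K' * E) := by gcongr
        _ = B * K' * ((1 + p ^ 2) * E) := by ring
        _ ≤ B * K' * (J * Q) := by gcongr
        _ = (B * K' * J) * Q := by ring
        _ ≤ A * Q := by gcongr; linarith
    · calc _ ≤ (1 + p ^ 2) * (B ^ 2 + d2) := by gcongr; exact habs2.trans hsum
        _ ≤ 2 * (B ^ 2 + d2) := by gcongr
        _ = 2 * B ^ 2 * 1 + 2 * d2 := by ring
        _ ≤ 2 * B ^ 2 * (K' * E) + 2 * d2 := by gcongr
        _ ≤ 2 * B ^ 2 * (K' * (J * Q)) + 2 * d2 := by gcongr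
        _ = (2 * B ^ 2 * K' * J) * Q + 2 * d2 := by ring
        _ ≤ A * Q + 2 * d2 := by gcongr; linarith
    · refine (habs2.trans hsum).trans ?_
      gcongr
      rw [← div_eq_mul_inv, le_div_iff₀ hp2]
      calc B ^ 2 * (1 + p ^ 2) ≤ B ^ 2 * 2 := by gcongr
        _ ≤ A := by linarith
  · have hm : (Ioc (0:ℝ) 1).indicator (fun l => |deriv (deriv ψ) l|) p = 0 :=
      indicator_of_notMem (fun h => absurd h.2 (not_le.2 hp1)) _
    rw [hm]
    have h1 := hD1 p hp1.le
    have h2 := hD2 p hp1.le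
    have hsd : s * d1 ≤ D₁ * (s * ψ p) / p := by
      rw [le_div_iff₀ hp]
      nlinarith
    have hsd' : s * d1 ≤ D₁ * (s * ψ p) := by
      refine hsd.trans (div_le_self (by positivity) hp1.le)
    have hsd2 : s * d2 ≤ D₂ * (s * ψ p) / p ^ 2 := by
      rw [le_div_iff₀ (by positivity)]
      nlinarith
    have hsum : ((s * d1) ^ 2 + s * d2) * f ≤ D * F / p ^ 2 := by
      calc ((s * d1) ^ 2 + s * d2) * f
          ≤ ((D₁ * (s * ψ p) / p) ^ 2 + D₂ * (s * ψ p) / p ^ 2) * f := by gcongr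
        _ = (D₁ ^ 2 * ((s * ψ p) ^ 2 * f) + D₂ * ((s * ψ p) * f)) / p ^ 2 := by
            field_simp
        _ ≤ (D₁ ^ 2 * (8 * F) + D₂ * (2 * F)) / p ^ 2 := by gcongr
        _ = D * F / p ^ 2 := by rw [hD]; ring
    have hratio : (1 + p ^ 2) / p ^ 2 ≤ 2 := by
      rw [div_le_iff₀ (by positivity)]
      nlinarith
    refine ⟨?_, ?_, ?_⟩
    · calc (1 + p ^ 2) * (s * d1 * f) ≤ (1 + p ^ 2) * (D₁ * (s * ψ p) * f) := by gcongr
        _ = (1 + p ^ 2) * (D₁ * (s * ψ p * f)) := by ring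
        _ ≤ (1 + p ^ 2) * (D₁ * (2 * F)) := by gcongr
        _ ≤ (1 + p ^ 2) * (D₁ * (2 * (K * E))) := by gcongr
        _ = 2 * D₁ * K * ((1 + p ^ 2) * E) := by ring
        _ ≤ 2 * D₁ * K * (J * Q) := by gcongr
        _ = (2 * D₁ * K * J) * Q := by ring
        _ ≤ A * Q := by gcongr; linarith
    · calc _ ≤ (1 + p ^ 2) * (D * F / p ^ 2) := by gcongr; exact habs2.trans hsum
        _ = ((1 + p ^ 2) / p ^ 2) * (D * F) := by ring
        _ ≤ 2 * (D * (K * E)) := by gcongr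
        _ ≤ 2 * (D * (K * (J * Q))) := by gcongr
        _ = (2 * D * K * J) * Q := by ring
        _ ≤ A * Q := by gcongr; linarith
        _ = A * Q + 2 * 0 := by ring
    · refine (habs2.trans hsum).trans ?_
      rw [add_zero, ← div_eq_mul_inv, le_div_iff₀ hp2]
      calc D * F / p ^ 2 * (1 + p ^ 2) = ((1 + p ^ 2) / p ^ 2) * (D * F) := by ring
        _ ≤ 2 * (D * 1) := by gcongr
        _ ≤ A := by linarith

open MeasureTheory Filter Topology Set in
/-- The oscillatory integral with amplitude `a * exp (-s ψ)`. -/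
lemma aux_amp (ψ : ℝ → ℝ) (hmeas : Measurable ψ) (hnonneg : ∀ p : ℝ, 0 ≤ ψ p)
    (hdiff1 : ∀ p : ℝ, 0 < p → DifferentiableAt ℝ ψ p)
    (hdiff2 : ∀ p : ℝ, 0 < p → DifferentiableAt ℝ (deriv ψ) p)
    (C₀ : ℝ) (hC0 : ∀ p : ℝ, ψ p ≤ C₀ * p ^ 2)
    (L : ℝ) (hL : Tendsto (deriv ψ) (𝓝[>] 0) (𝓝 L))
    (q A : ℝ) (m : ℝ → ℝ) (hq : 0 < q)
    (im : IntegrableOn m (Ioi 0)) (s : ℝ) (hs : 0 < s)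
    (b1 : ∀ p, 0 < p → (1 + p ^ 2) * Real.exp (-s * ψ p)
        ≤ A * ((s ^ 2)⁻¹ * Real.exp (-(q * s) * p)))
    (b2 : ∀ p, 0 < p → (1 + p ^ 2) * |-s * deriv ψ p * Real.exp (-s * ψ p)|
        ≤ A * ((s ^ 2)⁻¹ * Real.exp (-(q * s) * p)))
    (b3 : ∀ p, 0 < p → 
        (1 + p ^ 2) * |((s * deriv ψ p) ^ 2 - s * deriv (deriv ψ) p) * Real.exp (-s * ψ p)|
        ≤ A * ((s ^ 2)⁻¹ * Real.exp (-(q * s) * p)) + 2 * m p)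
    (a a1 a2 : ℝ → ℝ) (ha : ∀ p, HasDerivAt a (a1 p) p) (ha1 : ∀ p, HasDerivAt a1 (a2 p) p)
    (ha2 : Continuous a2) (η : ℝ) (hη : 0 ≤ η)
    (e0 : ∀ p, 0 < p → |a p| ≤ η * (1 + p ^ 2)) (e1 : ∀ p, 0 < p → |a1 p| ≤ 2 * η * (1 + p))
    (e2 : ∀ p, 0 < p → |a2 p| ≤ 2 * η) :
    IntegrableOn (fun p => a p * Real.exp (-s * ψ p)) (Ioi 0) ∧
    (∫ p in Ioi (0:ℝ), |a p * Real.exp (-s * ψ p)|) ≤ η * A / (q * s ^ 3) ∧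
    (∫ p in Ioi (0:ℝ), |a2 p * Real.exp (-s * ψ p)
        + 2 * (a1 p * (-s * deriv ψ p * Real.exp (-s * ψ p)))
        + a p * (((s * deriv ψ p) ^ 2 - s * deriv (deriv ψ) p) * Real.exp (-s * ψ p))|)
      ≤ 11 * η * A / (q * s ^ 3) + 2 * η * (∫ p in Ioi (0:ℝ), m p) ∧
    ∀ x θ : ℝ, a 0 * Real.sin θ = 0 →
      x ^ 2 * |∫ p in Ioi (0:ℝ), Real.cos (p * x + θ) * (a p * Real.exp (-s * ψ p))|
        ≤ |a1 0 - a 0 * (s * L)| + ∫ p in Ioi (0:ℝ), |a2 p * Real.exp (-s * ψ p)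
        + 2 * (a1 p * (-s * deriv ψ p * Real.exp (-s * ψ p)))
        + a p * (((s * deriv ψ p) ^ 2 - s * deriv (deriv ψ) p) * Real.exp (-s * ψ p))| := by
  set f : ℝ → ℝ := fun p => Real.exp (-s * ψ p) with hf
  set f1 : ℝ → ℝ := fun p => -s * deriv ψ p * Real.exp (-s * ψ p) with hf1
  set f2 : ℝ → ℝ := fun p => ((s * deriv ψ p) ^ 2 - s * deriv (deriv ψ) p) * Real.exp (-s * ψ p) with hf2
  set Q : ℝ → ℝ := fun p => (s ^ 2)⁻¹ * Real.exp (-(q * s) * p) with hQ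
  have hqs : -(q * s) < 0 := by have := mul_pos hq hs; linarith
  have iQ : IntegrableOn Q (Ioi 0) := (integrableOn_exp_mul_Ioi hqs 0).const_mul _
  have eQ : ∫ p in Ioi (0:ℝ), Q p = 1 / (q * s ^ 3) := by
    simp only [hQ]
    rw [integral_const_mul, integral_exp_mul_Ioi hqs]
    simp
    field_simp
  have hQ0 : ∀ p, 0 ≤ Q p := fun p => by positivity
  have tQ : Tendsto Q atTop (𝓝 0) := by
    have h1 : Tendsto (fun p : ℝ => -(q * s) * p) atTop atBot :=
      tendsto_id.const_mul_atTop_of_neg hqs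
    have := (Real.tendsto_exp_atBot.comp h1).const_mul ((s ^ 2)⁻¹)
    simpa [hQ] using this
  have df : ∀ p ∈ Ioi (0:ℝ), HasDerivAt f (f1 p) p := by
    intro p hp
    have h := ((hdiff1 p hp).hasDerivAt.const_mul (-s)).exp
    refine h.congr_deriv ?_
    simp only [hf1]; ring
  have df1 : ∀ p ∈ Ioi (0:ℝ), HasDerivAt f1 (f2 p) p := by
    intro p hp
    have h := ((hdiff2 p hp).hasDerivAt.const_mul (-s)).mul (df p hp)
    refine h.congr_deriv ?_
    simp only [hf1, hf2, hf]; ring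
  have mf : Measurable f := by fun_prop
  have md : Measurable (deriv ψ) := measurable_deriv _
  have mdd : Measurable (deriv (deriv ψ)) := measurable_deriv _
  have mf1 : Measurable f1 := by fun_prop
  have mf2 : Measurable f2 := by fun_prop
  have ca : Continuous a := continuous_iff_continuousAt.2 fun p => (ha p).continuousAt
  have ca1 : Continuous a1 := continuous_iff_continuousAt.2 fun p => (ha1 p).continuousAt
  have B1 : ∀ p, 0 < p → |f p| * (1 + p ^ 2) ≤ A * Q p := fun p hp => by
    have h := b1 p hp
    simp only [hf, abs_of_pos (Real.exp_pos _)]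
    rw [mul_comm]; exact h
  have B2 : ∀ p, 0 < p → |f1 p| * (1 + p ^ 2) ≤ A * Q p := fun p hp => by
    rw [mul_comm]; exact b2 p hp
  have B3 : ∀ p, 0 < p → |f2 p| * (1 + p ^ 2) ≤ A * Q p + 2 * m p := fun p hp => by
    rw [mul_comm]; exact b3 p hp
  have hpp : ∀ p : ℝ, 0 < p → 1 + p ≤ 2 * (1 + p ^ 2) := fun p hp => by nlinarith [sq_nonneg (p - 1)]
  have g0 : ∀ p, 0 < p → |a p * f p| ≤ η * A * Q p := by
    intro p hp
    rw [abs_mul]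
    calc |a p| * |f p| ≤ η * (1 + p ^ 2) * |f p| := by gcongr; exact e0 p hp
      _ = η * (|f p| * (1 + p ^ 2)) := by ring
      _ ≤ η * (A * Q p) := mul_le_mul_of_nonneg_left (B1 p hp) hη
      _ = _ := by ring
  have ca1f : ∀ (F : ℝ → ℝ) p, 0 < p → |F p| * (1 + p ^ 2) ≤ A * Q p → |a1 p * F p| ≤ 4 * η * A * Q p := by
    intro F p hp h
    rw [abs_mul]
    calc |a1 p| * |F p| ≤ 2 * η * (2 * (1 + p ^ 2)) * |F p| := by
          gcongr
          exact (e1 p hp).trans (by gcongr; exact hpp p hp)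
      _ = 4 * η * (|F p| * (1 + p ^ 2)) := by ring
      _ ≤ 4 * η * (A * Q p) := by gcongr
      _ = _ := by ring
  have g1 : ∀ p, 0 < p → |a1 p * f p + a p * f1 p| ≤ 5 * η * A * Q p := by
    intro p hp
    have h1 := ca1f f p hp (B1 p hp)
    have h2 : |a p * f1 p| ≤ η * A * Q p := by
      rw [abs_mul]
      calc |a p| * |f1 p| ≤ η * (1 + p ^ 2) * |f1 p| := by gcongr; exact e0 p hp
        _ = η * (|f1 p| * (1 + p ^ 2)) := by ring
        _ ≤ η * (A * Q p) := mul_le_mul_of_nonneg_left (B2 p hp) hη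
        _ = _ := by ring
    have := abs_add_le (a1 p * f p) (a p * f1 p)
    linarith
  have g2 : ∀ p, 0 < p → |a2 p * f p + 2 * (a1 p * f1 p) + a p * f2 p|
      ≤ 11 * η * A * Q p + 2 * η * m p := by
    intro p hp
    have h1 : |a2 p * f p| ≤ 2 * η * A * Q p := by
      rw [abs_mul]
      have h := B1 p hp
      have h' : |f p| ≤ |f p| * (1 + p ^ 2) := le_mul_of_one_le_right (abs_nonneg _) (by nlinarith [sq_nonneg p])
      calc |a2 p| * |f p| ≤ 2 * η * (A * Q p) := by
            gcongr
            · exact e2 p hp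
            · exact h'.trans h
        _ = _ := by ring
    have h2 := ca1f f1 p hp (B2 p hp)
    have h3 : |a p * f2 p| ≤ η * A * Q p + 2 * η * m p := by
      rw [abs_mul]
      calc |a p| * |f2 p| ≤ η * (1 + p ^ 2) * |f2 p| := by gcongr; exact e0 p hp
        _ = η * (|f2 p| * (1 + p ^ 2)) := by ring
        _ ≤ η * (A * Q p + 2 * m p) := mul_le_mul_of_nonneg_left (B3 p hp) hη
        _ = _ := by ring
    have h4 := abs_add_le (a2 p * f p + 2 * (a1 p * f1 p)) (a p * f2 p)
    have h5 := abs_add_le (a2 p * f p) (2 * (a1 p * f1 p))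
    have h6 : |2 * (a1 p * f1 p)| = 2 * |a1 p * f1 p| := by rw [abs_mul, abs_two]
    linarith
  have ig : IntegrableOn (fun p => a p * f p) (Ioi 0) := by
    refine Integrable.mono' (iQ.const_mul (η * A)) (ca.measurable.mul mf).aestronglyMeasurable ?_
    exact (ae_restrict_iff' measurableSet_Ioi).2 (Eventually.of_forall fun p hp => g0 p hp)
  have ig2 : IntegrableOn (fun p => a2 p * f p + 2 * (a1 p * f1 p) + a p * f2 p) (Ioi 0) := by
    refine Integrable.mono' ((iQ.const_mul (11 * η * A)).add (im.const_mul (2 * η))) ?_ ?_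
    · have := ha2.measurable
      have := ca1.measurable
      have := ca.measurable
      exact Measurable.aestronglyMeasurable (by fun_prop)
    · exact (ae_restrict_iff' measurableSet_Ioi).2 (Eventually.of_forall fun p hp => g2 p hp)
  refine ⟨ig, ?_, ?_, ?_⟩
  · calc (∫ p in Ioi (0:ℝ), |a p * f p|) ≤ ∫ p in Ioi (0:ℝ), η * A * Q p :=
          setIntegral_mono_on ig.abs (iQ.const_mul _) measurableSet_Ioi fun p hp => g0 p hp
      _ = _ := by rw [integral_const_mul, eQ]; ring
  · calc (∫ p in Ioi (0:ℝ), |a2 p * f p + 2 * (a1 p * f1 p) + a p * f2 p|)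
          ≤ ∫ p in Ioi (0:ℝ), (11 * η * A * Q p + 2 * η * m p) :=
          setIntegral_mono_on ig2.abs ((iQ.const_mul _).add (im.const_mul _)) measurableSet_Ioi
            fun p hp => g2 p hp
      _ = _ := by
        rw [integral_add (iQ.const_mul _) (im.const_mul _), integral_const_mul (11 * η * A) Q,
          integral_const_mul (2 * η) m, eQ]
        ring
  · intro x θ hθ
    have zψ : Tendsto ψ (𝓝[>] 0) (𝓝 0) := by
      have h : Tendsto (fun p : ℝ => C₀ * p ^ 2) (𝓝[>] 0) (𝓝 0) := by
        have hc : Continuous (fun p : ℝ => C₀ * p ^ 2) := by fun_prop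
        have := (hc.tendsto 0).mono_left (nhdsWithin_le_nhds (s := Ioi 0))
        simpa using this
      exact squeeze_zero hnonneg hC0 h
    have zf : Tendsto f (𝓝[>] 0) (𝓝 1) := by
      have := (Real.continuous_exp.tendsto _).comp (zψ.const_mul (-s))
      simpa [hf, Function.comp_def] using this
    have zf1 : Tendsto f1 (𝓝[>] 0) (𝓝 (-s * L)) := by
      have := (hL.const_mul (-s)).mul zf
      simpa [hf1, hf] using this
    have za : Tendsto a (𝓝[>] 0) (𝓝 (a 0)) := (ca.tendsto 0).mono_left nhdsWithin_le_nhds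
    have za1 : Tendsto a1 (𝓝[>] 0) (𝓝 (a1 0)) := (ca1.tendsto 0).mono_left nhdsWithin_le_nhds
    refine aux_ibp (fun p => a p * f p) (fun p => a1 p * f p + a p * f1 p)
      (fun p => a2 p * f p + 2 * (a1 p * f1 p) + a p * f2 p) (a 0) (a1 0 - a 0 * (s * L)) x θ
      ?_ ?_ ig ig2 ?_ ?_ ?_ ?_ hθ
    · intro p hp
      exact (ha p).mul (df p hp)
    · intro p hp
      refine (((ha1 p).mul (df p hp)).add ((ha p).mul (df1 p hp))).congr_deriv ?_
      ring
    · simpa using za.mul zf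
    · have := (za1.mul zf).add (za.mul zf1)
      convert this using 2
      ring
    · have hb : Tendsto (fun p => η * A * Q p) atTop (𝓝 0) := by simpa using tQ.const_mul (η * A)
      refine squeeze_zero_norm' ?_ hb
      filter_upwards [eventually_gt_atTop 0] with p hp using g0 p hp
    · have hb : Tendsto (fun p => 5 * η * A * Q p) atTop (𝓝 0) := by
        simpa using tQ.const_mul (5 * η * A)
      refine squeeze_zero_norm' ?_ hb
      filter_upwards [eventually_gt_atTop 0] with p hp using g1 p hp


set_option maxHeartbeats 4000000 in
theorem stmt_15
    (β : ℝ) (hβ1 : 1 < β) (hβ2 : β ≤ 2)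
    (ψ : ℝ → ℝ)
    (hmeas : Measurable ψ)
    (heven : ∀ p : ℝ, ψ (-p) = ψ p)
    (hnonneg : ∀ p : ℝ, 0 ≤ ψ p)
    (hpos : ∀ p : ℝ, p ≠ 0 → 0 < ψ p)
    (hRV : ∀ l : ℝ, 0 < l →
      Filter.Tendsto (fun x => ψ (l * x) / ψ x) Filter.atTop (nhds (l ^ β)))
    (hdiff1 : ∀ p : ℝ, 0 < p → DifferentiableAt ℝ ψ p)
    (hdiff2 : ∀ p : ℝ, 0 < p → DifferentiableAt ℝ (deriv ψ) p)
    (D₁ D₂ : ℝ)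
    (hD1 : ∀ l : ℝ, 1 ≤ l → l * |deriv ψ l| ≤ D₁ * ψ l)
    (hD2 : ∀ l : ℝ, 1 ≤ l → l ^ 2 * |deriv (deriv ψ) l| ≤ D₂ * ψ l)
    (hint1 : MeasureTheory.IntegrableOn (fun l : ℝ => (deriv ψ l) ^ 2) (Set.Ioc (0:ℝ) 1))
    (hint2 : MeasureTheory.IntegrableOn (fun l : ℝ => |deriv (deriv ψ) l|) (Set.Ioc (0:ℝ) 1))
    (hint3 : MeasureTheory.IntegrableOn (fun l : ℝ => ψ l / l) (Set.Ioc (0:ℝ) 1))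
    (C₀ : ℝ) (hC0 : ∀ p : ℝ, ψ p ≤ C₀ * p ^ 2)
    (hliminf : 0 < Filter.liminf (fun p : ℝ => ψ p / p ^ 2) (nhdsWithin (0:ℝ) ({0}ᶜ))) :
    ∃ C h₀ : ℝ, 0 < h₀ ∧ ∀ δ : ℝ, 0 < δ → δ < 1 → ∀ h : ℝ, 0 < h → h ≤ h₀ →
      (∫ x : ℝ, ubar ψ δ x) ≤ C * psiInv ψ (1 / δ) ∧
      (∫ x : ℝ, ubar ψ δ x ^ 2) ≤ C * psiInv ψ (1 / δ) ^ 2 ∧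
      (∫ x : ℝ, vbar ψ δ h x) ≤ C * h / δ ^ 3 ∧
      (∫ x : ℝ, vbar ψ δ h x ^ 2) ≤ C * h ^ 2 / δ ^ 6 ∧
      (∫ x : ℝ, wbar ψ δ h x) ≤ C * h ^ 2 / δ ^ 3 ∧
      (∫ x : ℝ, wbar ψ δ h x ^ 2) ≤ C * h ^ 4 / δ ^ 6 := by
  classical
  obtain ⟨X, c, hX, hc, hgrow⟩ := aux_growth β hβ1 ψ hpos hRV hdiff1 D₁ hD1
  obtain ⟨r₀, C1, hr0, hC1, hinv⟩ := aux_inv ψ hmeas hnonneg hpos C₀ hC0 X c hX hc hgrow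
  obtain ⟨L, B, hB0, hL, hB⟩ := aux_deriv ψ hdiff2 hint2
  obtain ⟨q, A, m, hq, hA, hm0, im, hb⟩ := aux_bounds ψ hnonneg hpos D₁ D₂ hD1 hD2 hint2 X c hX hc
    hgrow B hB0 hB
  set I : ℝ := ∫ p in Set.Ioi (0:ℝ), m p with hI
  have hI0 : 0 ≤ I := MeasureTheory.integral_nonneg hm0
  have hpi1 : 1 / Real.pi ≤ 1 := by
    rw [div_le_one Real.pi_pos]
    linarith [Real.pi_gt_three]
  have hpi0 : 0 < 1 / Real.pi := by positivity
  have amp := fun (s : ℝ) (hs : 0 < s) (hs1 : s ≤ 1) =>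
    aux_amp ψ hmeas hnonneg hdiff1 hdiff2 C₀ hC0 L hL q A m hq im s hs
      (fun p hp => (hb s p hs hs1 hp).1) (fun p hp => (hb s p hs hs1 hp).2.1)
      (fun p hp => (hb s p hs hs1 hp).2.2.1)
  have cosle : ∀ (g : ℝ → ℝ) (x θ : ℝ), MeasureTheory.IntegrableOn g (Set.Ioi 0) →
      |∫ p in Set.Ioi (0:ℝ), Real.cos (p * x + θ) * g p| ≤ ∫ p in Set.Ioi (0:ℝ), |g p| := by
    intro g x θ hg
    refine (MeasureTheory.abs_integral_le_integral_abs).trans ?_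
    refine MeasureTheory.integral_mono_of_nonneg (Filter.Eventually.of_forall fun _ => abs_nonneg _)
      hg.abs (Filter.Eventually.of_forall fun p => ?_)
    simp only [abs_mul]
    exact mul_le_of_le_one_left (abs_nonneg _) (Real.abs_cos_le_one _)
  set V : ℝ := 2 + 11 * A / q + 2 * I with hV
  have hV0 : 0 ≤ V := by positivity
  have gen : ∀ (δ r : ℝ), 0 < δ → δ ≤ r → r ≤ 1 → ∀ (a a1 a2 : ℝ → ℝ),
      (∀ p, HasDerivAt a (a1 p) p) → (∀ p, HasDerivAt a1 (a2 p) p) → Continuous a2 →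
      ∀ η : ℝ, 0 ≤ η → (∀ p, 0 < p → |a p| ≤ η * (1 + p ^ 2)) →
      (∀ p, 0 < p → |a1 p| ≤ 2 * η * (1 + p)) → (∀ p, 0 < p → |a2 p| ≤ 2 * η) →
      a 0 = 0 → |a1 0| ≤ 2 * η → ∀ y θ : ℝ,
      |(1 / Real.pi) * ∫ p in Set.Ioi (0:ℝ), Real.cos (p * y + θ) * (a p * Real.exp (-r * ψ p))|
        ≤ 2 * (η * V / δ ^ 3) * (1 + y ^ 2)⁻¹ := by
    intro δ r hδ hδr hr1 a a1 a2 ha ha1 ha2 η hη e0 e1 e2 a00 a10 y θ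
    have hr : 0 < r := hδ.trans_le hδr
    obtain ⟨ig, k0, k2, kd⟩ := amp r hr hr1 a a1 a2 ha ha1 ha2 η hη e0 e1 e2
    have kd := kd y θ (by rw [a00, zero_mul])
    rw [a00, zero_mul, sub_zero] at kd
    have kc := cosle _ y θ ig
    have hr3 : δ ^ 3 ≤ r ^ 3 := by gcongr
    have h13 : r ^ 3 ≤ 1 := pow_le_one₀ hr.le hr1
    have hδ3 : 0 < δ ^ 3 := by positivity
    have hr30 : 0 < r ^ 3 := by positivity
    have hone : 1 ≤ 1 / δ ^ 3 := by rw [le_div_iff₀ hδ3]; linarith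
    have hinv3 : 1 / r ^ 3 ≤ 1 / δ ^ 3 := one_div_le_one_div_of_le hδ3 hr3
    have hAq : 0 ≤ A / q := by positivity
    have t1 : η * A / (q * r ^ 3) ≤ η * V / δ ^ 3 := by
      calc η * A / (q * r ^ 3) = η * (A / q) * (1 / r ^ 3) := by field_simp
        _ ≤ η * (A / q) * (1 / δ ^ 3) := by gcongr
        _ ≤ η * V * (1 / δ ^ 3) := by
            gcongr
            rw [hV, mul_div_assoc]
            linarith
        _ = _ := by ring
    have t2 : 2 * η + (11 * η * A / (q * r ^ 3) + 2 * η * I) ≤ η * V / δ ^ 3 := by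
      calc 2 * η + (11 * η * A / (q * r ^ 3) + 2 * η * I)
          = η * (2 * 1 + 11 * A / q * (1 / r ^ 3) + 2 * I * 1) := by field_simp; ring
        _ ≤ η * (2 * (1 / δ ^ 3) + 11 * A / q * (1 / δ ^ 3) + 2 * I * (1 / δ ^ 3)) := by gcongr
        _ = _ := by rw [hV]; ring
    have habs : |(1 / Real.pi) * ∫ p in Set.Ioi (0:ℝ), Real.cos (p * y + θ) * (a p * Real.exp (-r * ψ p))|
        ≤ |∫ p in Set.Ioi (0:ℝ), Real.cos (p * y + θ) * (a p * Real.exp (-r * ψ p))| := by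
      rw [abs_mul, abs_of_pos hpi0]
      exact mul_le_of_le_one_left (abs_nonneg _) hpi1
    refine aux_comb _ _ _ ?_ ?_
    · linarith
    · have := mul_le_mul_of_nonneg_left habs (sq_nonneg y)
      linarith
  -- the case of constant amplitude
  have one := fun (s : ℝ) (hs : 0 < s) (hs1 : s ≤ 1) =>
    amp s hs hs1 (fun _ => 1) (fun _ => 0) (fun _ => 0) (fun p => hasDerivAt_const p 1)
      (fun p => hasDerivAt_const p 0) continuous_const 1 zero_le_one
      (fun p _ => by simp; positivity) (fun p hp => by simp; linarith) (fun p _ => by simp)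
  have iexp : ∀ s : ℝ, 0 < s → s ≤ 1 →
      MeasureTheory.IntegrableOn (fun p => Real.exp (-s * ψ p)) (Set.Ioi 0) := by
    intro s hs hs1
    simpa using (one s hs hs1).1
  have icos : ∀ s x : ℝ, 0 < s → s ≤ 1 →
      MeasureTheory.IntegrableOn (fun p => Real.cos (p * x) * Real.exp (-s * ψ p)) (Set.Ioi 0) := by
    intro s x hs hs1
    refine MeasureTheory.Integrable.mono' (iexp s hs hs1) ?_ (Filter.Eventually.of_forall fun p => ?_)
    · exact Measurable.aestronglyMeasurable (by fun_prop)
    · rw [norm_mul, Real.norm_eq_abs, Real.norm_eq_abs, abs_of_pos (Real.exp_pos _)]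
      exact mul_le_of_le_one_left (Real.exp_pos _).le (Real.abs_cos_le_one _)
  set U : ℝ := |L| + (A * (Real.pi / 2) + I) with hU
  have hU0 : 0 ≤ U := by positivity
  set W : ℝ := C1 + U / r₀ with hW
  have hW0 : 0 ≤ W := by positivity
  have ub : ∀ δ : ℝ, 0 < δ → δ < 1 → ∀ r ∈ Set.Icc δ 1, ∀ x,
      |pdens ψ r x| ≤ 2 * (W * psiInv ψ (1 / δ)) * (1 + (x + 0) ^ 2)⁻¹ := by
    intro δ hδ hδ1 r hr x
    have hr0' : 0 < r := hδ.trans_le hr.1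
    obtain ⟨hR, hintR⟩ := hinv δ hδ hδ1
    set R := psiInv ψ (1 / δ) with hRd
    have hRpos : 0 < R := hr0.trans_le hR
    have kd := (one r hr0' hr.2).2.2.2 x 0 (by simp)
    simp only [one_mul, zero_mul, mul_zero, zero_add, zero_sub, add_zero, abs_neg] at kd
    have kc := cosle _ x 0 (iexp r hr0' hr.2)
    simp only [add_zero, Real.abs_exp] at kc
    have kmono : ∫ p in Set.Ioi (0:ℝ), Real.exp (-r * ψ p) ≤ ∫ p in Set.Ioi (0:ℝ), Real.exp (-δ * ψ p) := by
      refine MeasureTheory.integral_mono (iexp r hr0' hr.2) (iexp δ hδ hδ1.le) fun p => ?_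
      apply Real.exp_le_exp.2
      nlinarith [hnonneg p, hr.1]
    have kf : ∫ p in Set.Ioi (0:ℝ),
        |((r * deriv ψ p) ^ 2 - r * deriv (deriv ψ) p) * Real.exp (-r * ψ p)|
        ≤ A * (Real.pi / 2) + I := by
      have ik : MeasureTheory.IntegrableOn (fun p : ℝ => (1 + p ^ 2)⁻¹) (Set.Ioi 0) :=
        integrable_inv_one_add_sq.integrableOn
      have h := MeasureTheory.integral_mono_of_nonneg (μ := MeasureTheory.volume.restrict (Set.Ioi (0:ℝ)))
        (f := fun p => |((r * deriv ψ p) ^ 2 - r * deriv (deriv ψ) p) * Real.exp (-r * ψ p)|)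
        (g := fun p => A * (1 + p ^ 2)⁻¹ + m p)
        (Filter.Eventually.of_forall fun _ => abs_nonneg _) ((ik.const_mul A).add im)
        ((MeasureTheory.ae_restrict_iff' measurableSet_Ioi).2
          (Filter.Eventually.of_forall fun p hp => (hb r p hr0' hr.2 hp).2.2.2))
      rw [MeasureTheory.integral_add (ik.const_mul A) im, MeasureTheory.integral_const_mul,
        integral_Ioi_inv_one_add_sq, Real.arctan_zero, sub_zero] at h
      exact h
    have hrL : |r * L| ≤ |L| := by
      rw [abs_mul, abs_of_pos hr0']
      exact mul_le_of_le_one_left (abs_nonneg _) hr.2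
    have hUR : U ≤ U / r₀ * R := by
      rw [div_mul_eq_mul_div, le_div_iff₀ hr0]
      exact mul_le_mul_of_nonneg_left hR hU0
    have hCR : 0 ≤ C1 * R := by positivity
    have hUR0 : 0 ≤ U / r₀ * R := by positivity
    have hWR : W * R = C1 * R + U / r₀ * R := by rw [hW]; ring
    have habs : |pdens ψ r x| ≤ |∫ p in Set.Ioi (0:ℝ), Real.cos (p * x) * Real.exp (-r * ψ p)| := by
      rw [pdens, abs_mul, abs_of_pos hpi0]
      exact mul_le_of_le_one_left (abs_nonneg _) hpi1
    rw [add_zero]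
    refine aux_comb _ _ _ ?_ ?_
    · linarith
    · have := mul_le_mul_of_nonneg_left habs (sq_nonneg x)
      linarith
  have vb : ∀ δ h : ℝ, 0 < δ → δ < 1 → 0 < h → h ≤ 1 → ∀ r ∈ Set.Icc δ 1, ∀ x,
      |pdens ψ r (x + h) - pdens ψ r x| ≤ 2 * (h * V / δ ^ 3) * (1 + (x + h / 2) ^ 2)⁻¹ := by
    intro δ h hδ hδ1 hh hh1 r hr x
    have hr0' : 0 < r := hδ.trans_le hr.1
    have hlin : ∀ p : ℝ, HasDerivAt (fun p : ℝ => p * (h / 2)) (h / 2) p := fun p => by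
      simpa using (hasDerivAt_id p).mul_const (h / 2)
    have key := gen δ r hδ hr.1 hr.2 (fun p => 2 * Real.sin (p * (h / 2)))
      (fun p => h * Real.cos (p * (h / 2))) (fun p => -(h ^ 2 / 2) * Real.sin (p * (h / 2)))
      (fun p => ((hlin p).sin.const_mul 2).congr_deriv (by ring))
      (fun p => ((hlin p).cos.const_mul h).congr_deriv (by ring))
      (by fun_prop) h hh.le ?_ ?_ ?_ (by simp) (by simp [abs_of_pos hh]; linarith)
      (x + h / 2) (Real.pi / 2)
    · convert key using 2
      rw [pdens, pdens, ← mul_sub, ← MeasureTheory.integral_sub (icos r _ hr0' hr.2) (icos r _ hr0' hr.2)]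
      congr 2
      ext p
      rw [Real.cos_add_pi_div_two, ← sub_mul, Real.cos_sub_cos]
      rw [show (p * (x + h) + p * x) / 2 = p * (x + h / 2) by ring,
        show (p * (x + h) - p * x) / 2 = p * (h / 2) by ring]
      ring
    · intro p hp
      rw [abs_mul, abs_two]
      have h1 : |Real.sin (p * (h / 2))| ≤ p * (h / 2) := by
        have := Real.abs_sin_le_abs (x := p * (h / 2))
        rwa [abs_of_nonneg (a := p * (h / 2)) (by positivity)] at this
      have h2 : h * p ≤ h * (1 + p ^ 2) := by
        gcongr
        nlinarith [sq_nonneg (p - 1)]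
      linarith
    · intro p hp
      rw [abs_mul, abs_of_pos hh]
      have h1 := mul_le_mul_of_nonneg_left (Real.abs_cos_le_one (p * (h / 2))) hh.le
      nlinarith [mul_pos hh hp]
    · intro p hp
      rw [abs_mul, abs_neg, abs_of_nonneg (a := h ^ 2 / 2) (by positivity)]
      have h1 := mul_le_mul_of_nonneg_left (Real.abs_sin_le_one (p * (h / 2)))
        (show 0 ≤ h ^ 2 / 2 by positivity)
      nlinarith
  have wb : ∀ δ h : ℝ, 0 < δ → δ < 1 → 0 < h → h ≤ 1 → ∀ r ∈ Set.Icc δ 1, ∀ x,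
      |2 * pdens ψ r x - pdens ψ r (x + h) - pdens ψ r (x - h)|
        ≤ 2 * (h ^ 2 * V / δ ^ 3) * (1 + (x + 0) ^ 2)⁻¹ := by
    intro δ h hδ hδ1 hh hh1 r hr x
    have hr0' : 0 < r := hδ.trans_le hr.1
    have hlin : ∀ p : ℝ, HasDerivAt (fun p : ℝ => p * h) h p := fun p => by
      simpa using (hasDerivAt_id p).mul_const h
    have hh2 : 0 ≤ h ^ 2 := sq_nonneg h
    have key := gen δ r hδ hr.1 hr.2 (fun p => 2 * (1 - Real.cos (p * h)))
      (fun p => 2 * h * Real.sin (p * h)) (fun p => 2 * h ^ 2 * Real.cos (p * h))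
      (fun p => (((hlin p).cos.const_sub 1).const_mul 2).congr_deriv (by ring))
      (fun p => ((hlin p).sin.const_mul (2 * h)).congr_deriv (by ring))
      (by fun_prop) (h ^ 2) hh2 ?_ ?_ ?_ (by simp) (by simp; positivity) (x + 0) 0
    · convert key using 2
      have i0 := icos r x hr0' hr.2
      have i1 := icos r (x + h) hr0' hr.2
      have i2 := icos r (x - h) hr0' hr.2
      have e : 2 * pdens ψ r x - pdens ψ r (x + h) - pdens ψ r (x - h)
          = (1 / Real.pi) * ∫ p in Set.Ioi (0:ℝ), ((2 * (Real.cos (p * x) * Real.exp (-r * ψ p))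
            - Real.cos (p * (x + h)) * Real.exp (-r * ψ p))
            - Real.cos (p * (x - h)) * Real.exp (-r * ψ p)) := by
        have i01 : MeasureTheory.IntegrableOn (fun p => 2 * (Real.cos (p * x) * Real.exp (-r * ψ p))
            - Real.cos (p * (x + h)) * Real.exp (-r * ψ p)) (Set.Ioi 0) := (i0.const_mul 2).sub i1
        rw [MeasureTheory.integral_sub i01 i2,
          MeasureTheory.integral_sub (i0.const_mul 2) i1, MeasureTheory.integral_const_mul]
        simp only [pdens]
        ring
      rw [e]
      congr 2
      ext p
      rw [mul_add p x h, mul_sub p x h, Real.cos_add, Real.cos_sub, add_zero, add_zero]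
      ring
    · intro p hp
      have h0 := Real.one_sub_sq_div_two_le_cos (x := p * h)
      rw [abs_mul, abs_two, abs_of_nonneg (by linarith [Real.cos_le_one (p * h)])]
      nlinarith
    · intro p hp
      have h1 : |Real.sin (p * h)| ≤ p * h := by
        have := Real.abs_sin_le_abs (x := p * h)
        rwa [abs_of_nonneg (a := p * h) (by positivity)] at this
      rw [abs_mul, abs_of_pos (by positivity)]
      have h2 := mul_le_mul_of_nonneg_left h1 (show 0 ≤ 2 * h by positivity)
      nlinarith
    · intro p hp
      rw [abs_mul, abs_of_nonneg (a := 2 * h ^ 2) (by positivity)]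
      exact mul_le_of_le_one_right (by positivity) (Real.abs_cos_le_one _)
  have hπ := Real.pi_pos
  have c1 : 0 ≤ 2 * W * Real.pi := by positivity
  have c2 : 0 ≤ 4 * W ^ 2 * Real.pi := by positivity
  have c3 : 0 ≤ 2 * V * Real.pi := by positivity
  have c4 : 0 ≤ 4 * V ^ 2 * Real.pi := by positivity
  refine ⟨2 * W * Real.pi + 4 * W ^ 2 * Real.pi + 2 * V * Real.pi + 4 * V ^ 2 * Real.pi, 1, one_pos, ?_⟩
  intro δ hδ hδ1 h hh hh1
  have hR := (hinv δ hδ hδ1).1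
  set R := psiInv ψ (1 / δ) with hRd
  have hRpos : 0 < R := hr0.trans_le hR
  have fu := aux_final (ubar ψ δ) (2 * (W * R)) 0 (by positivity)
    (fun x => aux_sup (fun r => pdens ψ r x) δ _ hδ1 fun r hr => ub δ hδ hδ1 r hr x)
  have fv := aux_final (vbar ψ δ h) (2 * (h * V / δ ^ 3)) (h / 2) (by positivity)
    (fun x => aux_sup (fun r => |pdens ψ r (x + h) - pdens ψ r x|) δ _ hδ1 fun r hr => by
      rw [abs_abs]; exact vb δ h hδ hδ1 hh hh1 r hr x)
  have fw := aux_final (wbar ψ δ h) (2 * (h ^ 2 * V / δ ^ 3)) 0 (by positivity)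
    (fun x => aux_sup (fun r => |2 * pdens ψ r x - pdens ψ r (x + h) - pdens ψ r (x - h)|) δ _ hδ1
      fun r hr => by rw [abs_abs]; exact wb δ h hδ hδ1 hh hh1 r hr x)
  refine ⟨fu.1.trans ?_, fu.2.trans ?_, fv.1.trans ?_, fv.2.trans ?_, fw.1.trans ?_, fw.2.trans ?_⟩
  · calc 2 * (W * R) * Real.pi = (2 * W * Real.pi) * R := by ring
      _ ≤ _ := by gcongr; linarith
  · calc (2 * (W * R)) ^ 2 * Real.pi = (4 * W ^ 2 * Real.pi) * R ^ 2 := by ring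
      _ ≤ _ := by gcongr; linarith
  · calc 2 * (h * V / δ ^ 3) * Real.pi = (2 * V * Real.pi) * h / δ ^ 3 := by ring
      _ ≤ _ := by gcongr; linarith
  · calc (2 * (h * V / δ ^ 3)) ^ 2 * Real.pi = (4 * V ^ 2 * Real.pi) * h ^ 2 / δ ^ 6 := by
          field_simp; ring
      _ ≤ _ := by gcongr; linarith
  · calc 2 * (h ^ 2 * V / δ ^ 3) * Real.pi = (2 * V * Real.pi) * h ^ 2 / δ ^ 3 := by ring
      _ ≤ _ := by gcongr; linarith
  · calc (2 * (h ^ 2 * V / δ ^ 3)) ^ 2 * Real.pi = (4 * V ^ 2 * Real.pi) * h ^ 4 / δ ^ 6 := by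
          field_simp; ring
      _ ≤ _ := by gcongr; linarith
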